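/- For every unsatisfiable linear r-CNF formula φ, Space(φ) ≥ Width(φ) − r − 1. -/

import Mathlib

open Finset

/-- The two-element field. -/
abbrev F2 : Type := ZMod 2

/-- An `F2`-linear form in the variables `V`, given by its coefficients. -/
abbrev LinForm (V : Type) : Type := V → F2

/-- A linear literal: an equation `f = a` where `f` is a linear form and `a ∈ F2`. -/
abbrev LinLit (V : Type) : Type := LinForm V × F2

/-- A linear clause: a finite disjunction of linear literals. -/
abbrev LinClause (V : Type) : Type := Finset (LinLit V)

/-- A linear system: a finite conjunction of linear equations. -/
abbrev LinSystem (V : Type) : Type := Finset (LinLit V)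

/-- A linear CNF formula: a conjunction of linear clauses. -/
abbrev LinCNF (V : Type) : Type := Set (LinClause V)

variable {V : Type}

/-- Evaluation of a linear form at an assignment. -/
def evalForm [Fintype V] (f : LinForm V) (σ : V → F2) : F2 := ∑ v, f v * σ v

/-- The assignment `σ` satisfies the linear equation `l.1 = l.2`. -/
def LitSat [Fintype V] (σ : V → F2) (l : LinLit V) : Prop := evalForm l.1 σ = l.2

/-- The assignment `σ` satisfies the linear clause `C` (some literal of `C` holds). -/
def ClauseSat [Fintype V] (σ : V → F2) (C : LinClause V) : Prop := ∃ l ∈ C, LitSat σ l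

/-- The assignment `σ` is a solution of the linear system `S` (all equations hold). -/
def SysSat [Fintype V] (σ : V → F2) (S : LinSystem V) : Prop := ∀ l ∈ S, LitSat σ l

/-- The assignment `σ` satisfies the linear CNF `φ`. -/
def CNFSat [Fintype V] (σ : V → F2) (φ : LinCNF V) : Prop := ∀ C ∈ φ, ClauseSat σ C

/-- The linear CNF `φ` is unsatisfiable. -/
def Unsat [Fintype V] (φ : LinCNF V) : Prop := ¬ ∃ σ, CNFSat σ φ

/-- The positive literal `v = 1` for a single variable `v`. -/
def posLit [DecidableEq V] (v : V) : LinLit V := (Pi.single v 1, 1)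

/-- The negative literal `v = 0` for a single variable `v`. -/
def negLit [DecidableEq V] (v : V) : LinLit V := (Pi.single v 1, 0)

/-- A solution is `F`-proper if it satisfies every clause of `F`. -/
def FProper [Fintype V] (F : Set (LinClause V)) (σ : V → F2) : Prop := ∀ C ∈ F, ClauseSat σ C

/-- `φ` is `m`-extensible w.r.t. `F`: every linear system with fewer than `m` equations
that has an `F`-proper solution has, for each clause `C ∈ φ \ F`, an `F`-proper solution
satisfying `C`. -/
def Extensible [Fintype V] (φ : LinCNF V) (F : Set (LinClause V)) (m : ℕ) : Prop :=
  ∀ S : LinSystem V, S.card < m → (∃ σ, SysSat σ S ∧ FProper F σ) →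
    ∀ C ∈ φ \ F, ∃ τ, SysSat τ S ∧ FProper F τ ∧ ClauseSat τ C

/-- A configuration: a finite set of linear clauses kept in memory. -/
abbrev Config (V : Type) : Type := Finset (LinClause V)

/-- Semantic inference: `C` follows from clauses in `S` by the resolution rule or the
semantic weakening rule. -/
def InferSem [Fintype V] [DecidableEq V] (S : Config V) (C : LinClause V) : Prop :=
  (∃ (f : LinForm V) (A B : LinClause V),
      insert (f, (0 : F2)) A ∈ S ∧ insert (f, (1 : F2)) B ∈ S ∧ C = A ∪ B) ∨
  (∃ D ∈ S, ∀ σ, ClauseSat σ D → ClauseSat σ C)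

/-- The identically zero linear form. -/
def zeroForm (V : Type) : LinForm V := fun _ => 0

/-- Syntactic inference: `C` follows from clauses in `S` by the resolution rule,
the simplification rule, the syntactic weakening rule, or the addition rule. -/
def InferSyn [Fintype V] [DecidableEq V] (S : Config V) (C : LinClause V) : Prop :=
  (∃ (f : LinForm V) (A B : LinClause V),
      insert (f, (0 : F2)) A ∈ S ∧ insert (f, (1 : F2)) B ∈ S ∧ C = A ∪ B) ∨
  (insert ((zeroForm V, (1 : F2)) : LinLit V) C ∈ S) ∨
  (∃ (D : LinClause V) (f : LinForm V) (α : F2), D ∈ S ∧ C = insert (f, α) D) ∨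
  (∃ (D : LinClause V) (f₁ f₂ : LinForm V) (α₁ α₂ : F2),
      insert (f₁, α₁) (insert (f₂, α₂) D) ∈ S ∧
      C = insert (f₁, α₁) (insert (f₁ + f₂, α₁ + α₂ + 1) D))

/-- One step of a configuration-style refutation: download a clause of `φ`,
erase a clause, or add a clause inferred (via `Inf`) from the current configuration. -/
inductive ConfigStep [Fintype V] [DecidableEq V] (φ : LinCNF V)
    (Inf : Config V → LinClause V → Prop) : Config V → Config V → Prop
  | download {S : Config V} {C : LinClause V} (h : C ∈ φ) : ConfigStep φ Inf S (insert C S)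
  | erase {S : Config V} {C : LinClause V} (h : C ∈ S) : ConfigStep φ Inf S (S.erase C)
  | infer {S : Config V} {C : LinClause V} (h : Inf S C) : ConfigStep φ Inf S (insert C S)

/-- A configuration-style Res(⊕) refutation of `φ` with inference rules `Inf`:
a sequence of configurations starting from the empty configuration, each obtained from
the previous one by a basic step, ending with a configuration containing the empty
clause. -/
def IsConfigRefutation [Fintype V] [DecidableEq V] (φ : LinCNF V)
    (Inf : Config V → LinClause V → Prop) (π : List (Config V)) : Prop :=
  π.head? = some (∅ : Config V) ∧ List.Chain' (ConfigStep φ Inf) π ∧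
    ∃ S : Config V, π.getLast? = some S ∧ (∅ : LinClause V) ∈ S

/-- The space of a sequence of configurations: the maximum number of clauses in memory. -/
def spaceOf (π : List (Config V)) : ℕ := (π.map Finset.card).foldr max 0

/-- Width-bounded Res(⊕) derivability: `ResLinW φ w C` holds if `C` has a Res(⊕)
derivation from the clauses of `φ` in which every clause has width at most `w`. -/
inductive ResLinW [Fintype V] [DecidableEq V] (φ : LinCNF V) (w : ℕ) : LinClause V → Prop
  | ax {C : LinClause V} (hC : C ∈ φ) (hw : C.card ≤ w) : ResLinW φ w C
  | res {A B : LinClause V} {f : LinForm V}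
      (h₁ : ResLinW φ w (insert (f, (0 : F2)) A)) (h₂ : ResLinW φ w (insert (f, (1 : F2)) B))
      (hw : (A ∪ B).card ≤ w) : ResLinW φ w (A ∪ B)
  | weak {C D : LinClause V} (h : ResLinW φ w C)
      (himp : ∀ σ, ClauseSat σ C → ClauseSat σ D) (hw : D.card ≤ w) : ResLinW φ w D

/-- `φ` has a Res(⊕) refutation of width at most `w`. -/
def WidthLE [Fintype V] [DecidableEq V] (φ : LinCNF V) (w : ℕ) : Prop :=
  ResLinW φ w (∅ : LinClause V)

/-- `Space(φ)`: the minimum space of a configuration-style Res(⊕) refutation of `φ`. -/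
noncomputable def SpaceOfCNF [Fintype V] [DecidableEq V] (φ : LinCNF V) : ℕ :=
  sInf {s | ∃ π : List (Config V), IsConfigRefutation φ InferSem π ∧ spaceOf π = s}

/-- `Width(φ)`: the minimum width of a Res(⊕) refutation of `φ`. -/
noncomputable def WidthOfCNF [Fintype V] [DecidableEq V] (φ : LinCNF V) : ℕ :=
  sInf {w | WidthLE φ w}

section SpaceWidth

lemma evalForm_add_left [Fintype V] (f g : LinForm V) (x : V → F2) :
    evalForm (f + g) x = evalForm f x + evalForm g x := by
  simp [evalForm, add_mul, Finset.sum_add_distrib]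

lemma evalForm_add_right [Fintype V] (f : LinForm V) (x y : V → F2) :
    evalForm f (x + y) = evalForm f x + evalForm f y := by
  simp [evalForm, mul_add, Finset.sum_add_distrib]

lemma evalForm_single [Fintype V] [DecidableEq V] (v : V) (x : V → F2) :
    evalForm (Pi.single v 1) x = x v := by
  simp [evalForm, Pi.single_apply]

/-- The clause expressing the negation of a linear system. -/
def negClause [Fintype V] [DecidableEq V] (L : LinSystem V) : LinClause V :=
  L.image fun l => (l.1, l.2 + 1)

lemma clauseSat_negClause [Fintype V] [DecidableEq V] (x : V → F2) (L : LinSystem V) :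
    ClauseSat x (negClause L) ↔ ¬ SysSat x L := by
  have key : ∀ a b : F2, a = b + 1 ↔ ¬ a = b := by decide
  simp only [ClauseSat, negClause, Finset.exists_mem_image, SysSat, LitSat, key]
  push Not
  rfl

lemma negClause_insert [Fintype V] [DecidableEq V] (l : LinLit V) (L : LinSystem V) :
    negClause (insert l L) = insert (l.1, l.2 + 1) (negClause L) := by
  simp [negClause, Finset.image_insert]

lemma card_negClause_le [Fintype V] [DecidableEq V] (L : LinSystem V) : (negClause L).card ≤ L.card :=
  Finset.card_image_le

lemma sysSat_insert [Fintype V] [DecidableEq V] (x : V → F2) (l : LinLit V) (L : LinSystem V) :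
    SysSat x (insert l L) ↔ LitSat x l ∧ SysSat x L := by
  simp [SysSat]

lemma odd_sum_eq {a b c a' b' c' p q : F2} (ha : a = p) (ha' : ¬ a' = q) (hb' : b' = q)
    (hb : ¬ b = p) (hc : c = p → ¬ c' = q) (h : c + c' = p + q) :
    a + b + c = p ∧ a' + b' + c' = q := by
  revert a b c a' b' c' p q
  decide

/-- If `L` and `M` are jointly inconsistent, then a single linear consequence of `L` is
already inconsistent with `M`. -/
lemma exists_separating_lit [Fintype V] [DecidableEq V] (L M : LinSystem V)
    (h : ∀ x, SysSat x L → ¬ SysSat x M) :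
    ∃ e : LinLit V, (∀ x, SysSat x L → LitSat x e) ∧ ∀ x, LitSat x e → ¬ SysSat x M := by
  induction L using Finset.induction_on generalizing M with
  | empty =>
    exact ⟨(0, 0), by simp [LitSat, evalForm], fun x _ => h x (by simp [SysSat])⟩
  | insert l L _ ih =>
    obtain ⟨e, hLe, heM⟩ := ih (insert l M) fun x hx hM => by
      rw [sysSat_insert] at hM
      exact h x ((sysSat_insert x l L).2 ⟨hM.1, hx⟩) hM.2
    simp only [sysSat_insert] at heM ⊢
    by_contra! hcon
    obtain ⟨x, hxe, hxM⟩ := hcon e fun x hx => hLe x hx.2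
    obtain ⟨y, hyl, hyM⟩ := hcon l fun x hx => hx.1
    obtain ⟨z, hz, hzM⟩ := hcon (e.1 + l.1, e.2 + l.2) fun x hx => by
      have := hLe x hx.2
      simp only [LitSat, evalForm_add_left] at *
      rw [this, hx.1]
    have hxl := fun hl => heM x hxe ⟨hl, hxM⟩
    have hye := fun he => heM y he ⟨hyl, hyM⟩
    have hzz := fun he hl => heM z he ⟨hl, hzM⟩
    refine heM (x + y + z) ?_ ⟨?_, fun m hm => ?_⟩
    · simp only [LitSat, evalForm_add_left, evalForm_add_right] at *
      exact (odd_sum_eq hxe hxl hyl hye hzz hz).1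
    · simp only [LitSat, evalForm_add_left, evalForm_add_right] at *
      exact (odd_sum_eq hxe hxl hyl hye hzz hz).2
    · have h₁ : evalForm m.1 x = m.2 := hxM m hm
      have h₂ : evalForm m.1 y = m.2 := hyM m hm
      have h₃ : evalForm m.1 z = m.2 := hzM m hm
      simp only [LitSat, evalForm_add_right, h₁, h₂, h₃]
      generalize m.2 = a
      revert a
      decide

/-- If `L` implies the clause `C`, then a single linear consequence of `L` implies `C`. -/
lemma exists_interpolating_lit [Fintype V] [DecidableEq V] (L : LinSystem V) (C : LinClause V)
    (h : ∀ x, SysSat x L → ClauseSat x C) :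
    ∃ e : LinLit V, (∀ x, SysSat x L → LitSat x e) ∧ ∀ x, LitSat x e → ClauseSat x C := by
  have key : negClause (negClause C) = C := by
    have : ∀ a : F2, a + 1 + 1 = a := by decide
    simp [negClause, Finset.image_image, Function.comp_def, this]
  have hneg : ∀ x, ¬ SysSat x (negClause C) ↔ ClauseSat x C := fun x => by
    rw [← clauseSat_negClause, key]
  simpa only [hneg] using exists_separating_lit L (negClause C) fun x hx => (hneg x).2 (h x hx)

/-- A linear system implying all clauses of `S` has a consequence with at most `S.card`
equations that still implies all clauses of `S`. -/
lemma exists_small_subsystem [Fintype V] [DecidableEq V] (L : LinSystem V) (S : Config V)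
    (h : ∀ C ∈ S, ∀ x, SysSat x L → ClauseSat x C) :
    ∃ M : LinSystem V, M.card ≤ S.card ∧ (∀ x, SysSat x L → SysSat x M) ∧
      ∀ C ∈ S, ∀ x, SysSat x M → ClauseSat x C := by
  choose! e he₁ he₂ using fun C hC => exists_interpolating_lit L C (h C hC)
  refine ⟨S.image e, Finset.card_image_le, fun x hx l hl => ?_, fun C hC x hx => ?_⟩
  · obtain ⟨C, hC, rfl⟩ := Finset.mem_image.1 hl
    exact he₁ C hC x hx
  · exact he₂ C hC x (hx _ (Finset.mem_image_of_mem e hC))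

lemma ResLinW.resolve [Fintype V] [DecidableEq V] {φ : LinCNF V} {w : ℕ} {A B : LinClause V}
    {l : LinLit V} (h₁ : ResLinW φ w (insert l A))
    (h₂ : ResLinW φ w (insert (l.1, l.2 + 1) B)) (hw : (A ∪ B).card ≤ w) :
    ResLinW φ w (A ∪ B) := by
  obtain ⟨f, a⟩ := l
  have ha : ∀ a : F2, a = 0 ∨ a = 1 := by decide
  rcases ha a with rfl | rfl
  · exact .res h₁ (by simpa using h₂) hw
  · have h0 : (1 + 1 : F2) = 0 := by decide
    simp only [h0] at h₂
    rw [Finset.union_comm] at hw ⊢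
    exact .res h₂ h₁ hw

lemma ResLinW.resolve_all [Fintype V] [DecidableEq V] {φ : LinCNF V} {w : ℕ}
    {A C : LinClause V} (hw : A.card + C.card ≤ w)
    (hC : ∀ l ∈ C, ResLinW φ w (insert (l.1, l.2 + 1) A)) (h : ResLinW φ w (A ∪ C)) :
    ResLinW φ w A := by
  induction C using Finset.induction_on with
  | empty => simpa using h
  | insert l C hl ih =>
    rw [Finset.card_insert_of_notMem hl] at hw
    refine ih (by omega) (fun m hm => hC m (Finset.mem_insert_of_mem hm)) ?_
    have hcard := Finset.card_union_le A C
    have hunion : A ∪ C ∪ A = A ∪ C := by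
      ext; simp; tauto
    rw [Finset.union_insert] at h
    have := h.resolve (hC l (Finset.mem_insert_self _ _)) (by rw [hunion]; omega)
    rwa [hunion] at this

lemma Unsat.exists_mem_not_clauseSat [Fintype V] {φ : LinCNF V} (h : Unsat φ) (x : V → F2) :
    ∃ C ∈ φ, ¬ ClauseSat x C := by
  by_contra! hcon
  exact h ⟨x, hcon⟩

/-- Backward induction along a configuration refutation: the negation of every small linear
system implying the first configuration has a narrow derivation. -/
lemma resLinW_negClause_of_chain [Fintype V] [DecidableEq V] {φ : LinCNF V} {r s : ℕ}
    (hunsat : Unsat φ) (hr : ∀ C ∈ φ, C.card ≤ r) (π : List (Config V)) (S : Config V)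
    (hchain : List.IsChain (ConfigStep φ InferSem) (S :: π))
    (hs : ∀ T ∈ S :: π, T.card ≤ s)
    (hlast : ∃ T, (S :: π).getLast? = some T ∧ (∅ : LinClause V) ∈ T)
    (L : LinSystem V) (hL : L.card ≤ S.card) (himp : ∀ C ∈ S, ∀ x, SysSat x L → ClauseSat x C) :
    ResLinW φ (s + r) (negClause L) := by
  have hcard := card_negClause_le L
  have hSs : S.card ≤ s := hs S (by simp)
  induction π generalizing S L with
  | nil =>
    obtain ⟨T, hT, hempty⟩ := hlast
    obtain rfl : S = T := by simpa using hT
    obtain ⟨C, hC, -⟩ := hunsat.exists_mem_not_clauseSat 0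
    have hrC := hr C hC
    refine .weak (.ax hC (by omega)) (fun x _ => ?_) (by omega)
    rw [clauseSat_negClause]
    intro hx
    simpa [ClauseSat] using himp ∅ hempty x hx
  | cons T π ih =>
    rw [List.isChain_cons_cons] at hchain
    have hTs : T.card ≤ s := hs T (by simp)
    have ih' := fun M hM hMT => ih T hchain.2 (fun U hU => hs U (List.mem_cons_of_mem _ hU))
      (by simpa using hlast) M hM hMT (card_negClause_le M) hTs
    cases hchain.1 with
    | @download C hC =>
      by_cases hCS : C ∈ S
      · rw [Finset.insert_eq_of_mem hCS] at ih'
        exact ih' L hL himp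
      · rw [Finset.card_insert_of_notMem hCS] at hTs ih'
        have hrC := hr C hC
        have hunion := Finset.card_union_le (negClause L) C
        refine ResLinW.resolve_all (C := C) (by omega) (fun l hl => ?_) ?_
        · rw [← negClause_insert]
          refine ih' _ ((Finset.card_insert_le _ _).trans (by omega)) fun D hD x hx => ?_
          rw [sysSat_insert] at hx
          rcases Finset.mem_insert.1 hD with rfl | hD
          · exact ⟨l, hl, hx.1⟩
          · exact himp D hD x hx.2
        · refine .weak (.ax hC (by omega)) (fun x ⟨l, hl, hx⟩ => ?_) (by omega)
          exact ⟨l, Finset.mem_union_right _ hl, hx⟩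
    | @erase C hC =>
      obtain ⟨M, hM, hLM, hMS⟩ := exists_small_subsystem L (S.erase C) fun D hD =>
        himp D (Finset.mem_of_mem_erase hD)
      refine .weak (ih' M hM hMS) (fun x hx => ?_) (by omega)
      rw [clauseSat_negClause] at hx ⊢
      exact fun h => hx (hLM x h)
    | @infer C hC =>
      refine ih' L (hL.trans (Finset.card_le_card (Finset.subset_insert _ _))) fun D hD x hx => ?_
      rcases Finset.mem_insert.1 hD with rfl | hD
      · rcases hC with ⟨f, A, B, hA, hB, rfl⟩ | ⟨E, hE, hED⟩
        · obtain ⟨l, hl, hlx⟩ := himp _ hA x hx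
          obtain ⟨m, hm, hmx⟩ := himp _ hB x hx
          rcases Finset.mem_insert.1 hl with rfl | hl
          · rcases Finset.mem_insert.1 hm with rfl | hm
            · exact absurd (Eq.trans (Eq.symm hlx) hmx) zero_ne_one
            · exact ⟨m, Finset.mem_union_right _ hm, hmx⟩
          · exact ⟨l, Finset.mem_union_left _ hl, hlx⟩
        · exact hED x (himp E hE x hx)
      · exact himp D hD x hx

lemma card_le_spaceOf {π : List (Config V)} {T : Config V} (hT : T ∈ π) :
    T.card ≤ spaceOf π := by
  induction π with
  | nil => simp at hT
  | cons S π ih =>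
    simp only [spaceOf, List.map_cons, List.foldr_cons] at ih ⊢
    rcases List.mem_cons.1 hT with rfl | hT
    · exact le_max_left _ _
    · exact (ih hT).trans (le_max_right _ _)

lemma IsConfigRefutation.widthLE [Fintype V] [DecidableEq V] {φ : LinCNF V} {r : ℕ}
    (hunsat : Unsat φ) (hr : ∀ C ∈ φ, C.card ≤ r) {π : List (Config V)}
    (hπ : IsConfigRefutation φ InferSem π) : WidthLE φ (spaceOf π + r) := by
  obtain ⟨hhead, hchain, hlast⟩ := hπ
  cases π with
  | nil => simp at hhead
  | cons S π =>
    obtain rfl : S = ∅ := by simpa using hhead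
    simpa [negClause, WidthLE] using resLinW_negClause_of_chain hunsat hr π ∅ hchain
      (fun T hT => card_le_spaceOf hT) hlast ∅ (by simp) (by simp)

/-- Completeness: if every solution of `L` is determined by its values on `T`, then the
negation of `L` is derivable. -/
lemma Unsat.resLinW_negClause [Fintype V] [DecidableEq V] {φ : LinCNF V} (hunsat : Unsat φ)
    (T : Finset V) (L : LinSystem V)
    (hL : ∀ x y, SysSat x L → SysSat y L → (∀ v ∈ T, x v = y v) → x = y) :
    ResLinW φ (Fintype.card (LinLit V)) (negClause L) := by
  induction T using Finset.induction_on generalizing L with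
  | empty =>
    obtain ⟨x, hx⟩ : ∃ x, ∀ y, SysSat y L → y = x := by
      by_cases h : ∃ x, SysSat x L
      · obtain ⟨x, hx⟩ := h
        exact ⟨x, fun y hy => hL y x hy hx (by simp)⟩
      · exact ⟨0, fun y hy => absurd ⟨y, hy⟩ h⟩
    obtain ⟨C, hC, hxC⟩ := hunsat.exists_mem_not_clauseSat x
    refine .weak (.ax hC (Finset.card_le_univ _)) (fun y hy => ?_) (Finset.card_le_univ _)
    rw [clauseSat_negClause]
    intro hyL
    exact hxC (hx y hyL ▸ hy)
  | insert v T _ ih =>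
    have key : ∀ a : F2, ResLinW φ (Fintype.card (LinLit V))
        (insert (Pi.single v 1, a + 1) (negClause L)) := fun a => by
      rw [← negClause_insert (Pi.single v 1, a)]
      refine ih _ fun x y hx hy hxy => ?_
      rw [sysSat_insert, LitSat, evalForm_single] at hx hy
      refine hL x y hx.2 hy.2 fun u hu => ?_
      rcases Finset.mem_insert.1 hu with rfl | hu
      · exact hx.1.trans hy.1.symm
      · exact hxy u hu
    simpa using (key 0).resolve (key (0 + 1)) (Finset.card_le_univ _)

lemma ResLinW.exists_reachable [Fintype V] [DecidableEq V] {φ : LinCNF V} {w : ℕ}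
    {C : LinClause V} (h : ResLinW φ w C) (S : Config V) :
    ∃ S', S ⊆ S' ∧ Relation.ReflTransGen (ConfigStep φ InferSem) S S' ∧ C ∈ S' := by
  induction h generalizing S with
  | @ax C hC _ =>
    exact ⟨insert C S, Finset.subset_insert _ _, .single (.download hC),
      Finset.mem_insert_self _ _⟩
  | @res A B f _ _ _ ih₁ ih₂ =>
    obtain ⟨S₁, hS₁, hr₁, hA⟩ := ih₁ S
    obtain ⟨S₂, hS₂, hr₂, hB⟩ := ih₂ S₁
    exact ⟨insert (A ∪ B) S₂, (hS₁.trans hS₂).trans (Finset.subset_insert _ _),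
      (hr₁.trans hr₂).tail (.infer (.inl ⟨f, A, B, hS₂ hA, hB, rfl⟩)),
      Finset.mem_insert_self _ _⟩
  | @weak C D _ himp _ ih =>
    obtain ⟨S₁, hS₁, hr₁, hC⟩ := ih S
    exact ⟨insert D S₁, hS₁.trans (Finset.subset_insert _ _),
      hr₁.tail (.infer (.inr ⟨C, hC, himp⟩)), Finset.mem_insert_self _ _⟩

lemma Unsat.exists_isConfigRefutation [Fintype V] [DecidableEq V] {φ : LinCNF V}
    (hunsat : Unsat φ) : ∃ π, IsConfigRefutation φ InferSem π := by
  obtain ⟨S, -, hS, hempty⟩ := (hunsat.resLinW_negClause Finset.univ ∅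
    fun x y _ _ h => funext fun v => h v (Finset.mem_univ v)).exists_reachable ∅
  obtain ⟨π, hchain, hlast⟩ := List.exists_isChain_cons_of_relationReflTransGen hS
  exact ⟨∅ :: π, rfl, hchain, S, by rw [List.getLast?_eq_some_getLast (by simp), hlast],
    by simpa [negClause] using hempty⟩

end SpaceWidth

/-- For every unsatisfiable linear `r`-CNF formula `φ`,
`Space(φ) ≥ Width(φ) − r − 1`. -/
theorem space_ge_width_sub
    {V : Type} [Fintype V] [DecidableEq V] (φ : LinCNF V) (r : ℕ)
    (hunsat : Unsat φ) (hr : ∀ C ∈ φ, C.card ≤ r) :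
    WidthOfCNF φ - r - 1 ≤ SpaceOfCNF φ := by 
  obtain ⟨π₀, hπ₀⟩ := hunsat.exists_isConfigRefutation
  obtain ⟨π, hπ, hs⟩ := Nat.sInf_mem
    (s := {s | ∃ π : List (Config V), IsConfigRefutation φ InferSem π ∧ spaceOf π = s})
    ⟨_, π₀, hπ₀, rfl⟩
  have hw : WidthOfCNF φ ≤ spaceOf π + r := Nat.sInf_le (hπ.widthLE hunsat hr)
  have hs' : spaceOf π = SpaceOfCNF φ := hs
  omega
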